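/- arXiv:2403.01887 — 2 statements merged into one kernel-verified Lean document; each statement's English description precedes it below -/
import Mathlib

section
/- Assume the setting below (case mindeg_q(G)=t/2) with q > 2 and t even. Then: (i) the homogeneous component of F_C(X,Y) of top total degree q^k + q^{2t} equals λ^{q^t}δC·(X^{q^{2t}}Y^{q^k} − X^{q^k}Y^{q^{2t}}); consequently the points at infinity of the projective curve C are exactly (0:1:0) and the points (1:ξ:0) with ξ^{q^{k−2t}} = ξ. (ii) For each such ξ, with F_C^h the degree-(q^k+q^{2t}) homogenization of F_C and f_ξ(Y,Z) := F_C^h(1, Y+ξ, Z), the multiplicity m_{P_ξ}(C) := min{ d : the degree-d homogeneous component of f_ξ is nonzero } satisfies m_{P_ξ}(C) ∈ {q^{2t}−q^t, q^{2t}}, and m_{P_ξ}(C) = q^{2t} if and only if ξ^{q^{gcd(k,t)}} = ξ. -/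
open MvPolynomial

noncomputable section

/-- `F(x) = x + δ x^(q^(2t))` (value at `x`). -/
def Fval (q t : ℕ) {Ω : Type*} [Field Ω] (δ x : Ω) : Ω := x + δ * x ^ q ^ (2 * t)

/-- `G(x) = x^(q^(t/2)) + ∑_{i=t/2+1}^{k-1} c_i x^(q^i) + C x^(q^k)` (value at `x`). -/
def Gval2 (q t k : ℕ) {Ω : Type*} [Field Ω] (c : ℕ → Ω) (Cc x : Ω) : Ω :=
  x ^ q ^ (t / 2) + (∑ i ∈ Finset.Ico (t / 2 + 1) k, c i * x ^ q ^ i) + Cc * x ^ q ^ k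

/-- `F` applied to a bivariate polynomial. -/
def FP (q t : ℕ) {Ω : Type*} [Field Ω] (δ : Ω) (u : MvPolynomial (Fin 2) Ω) :
    MvPolynomial (Fin 2) Ω := u + C δ * u ^ q ^ (2 * t)

/-- `G` applied to a bivariate polynomial. -/
def GP2 (q t k : ℕ) {Ω : Type*} [Field Ω] (c : ℕ → Ω) (Cc : Ω) (u : MvPolynomial (Fin 2) Ω) :
    MvPolynomial (Fin 2) Ω :=
  u ^ q ^ (t / 2) + (∑ i ∈ Finset.Ico (t / 2 + 1) k, C (c i) * u ^ q ^ i) + C Cc * u ^ q ^ k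

/-- The affine equation `F_C(X,Y)` of the curve `C` (case `mindeg_q G = t/2`). -/
def FC2 (q t k : ℕ) {Ω : Type*} [Field Ω] (δ : Ω) (c : ℕ → Ω) (Cc l : Ω) :
    MvPolynomial (Fin 2) Ω :=
  Matrix.det !![(X 0) ^ q ^ t, FP q t δ (X 0), GP2 q t k c Cc (X 0);
                (X 1) ^ q ^ t, FP q t δ (X 1), GP2 q t k c Cc (X 1);
                C (l ^ q ^ t), C (Fval q t δ l), C (Gval2 q t k c Cc l)]

/-- `f_ξ(Y,Z) := F_C^h(1, Y+ξ, Z)`. -/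
def fxi {Ω : Type*} [Field Ω] (FCh : MvPolynomial (Fin 3) Ω) (ξ : Ω) :
    MvPolynomial (Fin 2) Ω :=
  aeval ![1, X 0 + C ξ, X 1] FCh

/-- The multiplicity: the least `d` such that the degree-`d` homogeneous component is
nonzero. -/
def multAt {Ω : Type*} [Field Ω] (f : MvPolynomial (Fin 2) Ω) : ℕ :=
  sInf {d : ℕ | homogeneousComponent d f ≠ 0}

section helpers

variable {Ω : Type*} [Field Ω]

def Ex {M : Type*} [AddCommGroup M] [Module Ω M] (t k : ℕ) (δ a b g Cc : Ω) (e : ℕ → Ω)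
    (W : ℕ → ℕ → M) : M :=
  g • (W t 0 + δ • W t (2 * t))
    - b • ((∑ i ∈ Finset.Ico (t / 2) k, e i • W t i) + Cc • W t k)
    + a • ((∑ i ∈ Finset.Ico (t / 2) k, e i • (W 0 i + δ • W (2 * t) i))
        + Cc • (W 0 k + δ • W (2 * t) k))

lemma Ex_map {M N : Type*} [AddCommGroup M] [Module Ω M] [AddCommGroup N] [Module Ω N]
    (L : M →ₗ[Ω] N) (t k : ℕ) (δ a b g Cc : Ω) (e : ℕ → Ω) (W : ℕ → ℕ → M) :
    L (Ex t k δ a b g Cc e W) = Ex t k δ a b g Cc e (fun i j => L (W i j)) := by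
  simp only [Ex, map_add, map_sub, map_smul, map_sum]

lemma Ex_mem {M : Type*} [AddCommGroup M] [Module Ω M] (S : Submodule Ω M)
    (t k : ℕ) (h2tk : 2 * t < k) (δ a b g Cc : Ω) (e : ℕ → Ω) (W : ℕ → ℕ → M)
    (hW : ∀ i j, i ≤ 2 * t → j ≤ k → W i j ∈ S) :
    Ex t k δ a b g Cc e W ∈ S := by
  unfold Ex
  refine S.add_mem (S.sub_mem (S.smul_mem _ (S.add_mem ?_ (S.smul_mem _ ?_)))
    (S.smul_mem _ (S.add_mem (S.sum_mem fun i hi => S.smul_mem _ ?_) (S.smul_mem _ ?_))))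
    (S.smul_mem _ (S.add_mem (S.sum_mem fun i hi => S.smul_mem _ (S.add_mem ?_ (S.smul_mem _ ?_)))
      (S.smul_mem _ (S.add_mem ?_ (S.smul_mem _ ?_)))))
  all_goals try rw [Finset.mem_Ico] at hi
  all_goals apply hW <;> omega

lemma Ex_collapse {M : Type*} [AddCommGroup M] [Module Ω M]
    (t k : ℕ) (h2tk : 2 * t < k) (δ a b g Cc : Ω) (e : ℕ → Ω) (W : ℕ → ℕ → M)
    (hW : ∀ i j, i ≤ 2 * t → j < k → W i j = 0) :
    Ex t k δ a b g Cc e W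
      = a • Cc • (W 0 k + δ • W (2 * t) k) - b • Cc • W t k := by
  have h1 : ∑ i ∈ Finset.Ico (t / 2) k, e i • W t i = 0 := by
    refine Finset.sum_eq_zero fun i hi => ?_
    rw [Finset.mem_Ico] at hi
    rw [hW t i (by omega) hi.2, smul_zero]
  have h2 : ∑ i ∈ Finset.Ico (t / 2) k, e i • (W 0 i + δ • W (2 * t) i) = 0 := by
    refine Finset.sum_eq_zero fun i hi => ?_
    rw [Finset.mem_Ico] at hi
    rw [hW 0 i (by omega) hi.2, hW (2 * t) i (by omega) hi.2]
    simp
  unfold Ex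
  rw [h1, h2, hW t 0 (by omega) (by omega), hW t (2 * t) (by omega) (by omega)]
  simp only [smul_zero, add_zero, zero_add, zero_sub]
  abel

def br2 (Ω : Type*) [Field Ω] (q i j : ℕ) : MvPolynomial (Fin 2) Ω :=
  X 0 ^ q ^ i * X 1 ^ q ^ j - X 0 ^ q ^ j * X 1 ^ q ^ i

def br3 (Ω : Type*) [Field Ω] (q D i j : ℕ) : MvPolynomial (Fin 3) Ω :=
  (X 0 ^ q ^ i * X 1 ^ q ^ j - X 0 ^ q ^ j * X 1 ^ q ^ i) * X 2 ^ (D - (q ^ i + q ^ j))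

lemma GP2_eq (q t k : ℕ) (htk : t / 2 < k) (c : ℕ → Ω) (Cc : Ω) (u : MvPolynomial (Fin 2) Ω) :
    GP2 q t k c Cc u = (∑ i ∈ Finset.Ico (t / 2) k,
      C (if i = t / 2 then 1 else c i) * u ^ q ^ i) + C Cc * u ^ q ^ k := by
  rw [Finset.sum_eq_sum_Ico_succ_bot htk]
  unfold GP2
  congr 2
  · simp
  · refine Finset.sum_congr rfl fun i hi => ?_
    rw [Finset.mem_Ico] at hi
    rw [if_neg (by omega)]

lemma FC2_eq (q t k : ℕ) (htk : t / 2 < k) (δ : Ω) (c : ℕ → Ω) (Cc l : Ω) :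
    FC2 q t k δ c Cc l = Ex t k δ (l ^ q ^ t) (Fval q t δ l) (Gval2 q t k c Cc l) Cc
      (fun i => if i = t / 2 then 1 else c i) (br2 Ω q) := by
  unfold FC2 Ex FP br2
  generalize l ^ q ^ t = a
  generalize Fval q t δ l = b
  generalize Gval2 q t k c Cc l = g
  rw [Matrix.det_fin_three, GP2_eq q t k htk, GP2_eq q t k htk]
  simp only [MvPolynomial.smul_eq_C_mul]
  generalize (fun i => if i = t / 2 then 1 else c i) = e
  have h1 : ∑ i ∈ Finset.Ico (t / 2) k, C (if i = t / 2 then 1 else c i) *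
      ((X 0 : MvPolynomial (Fin 2) Ω) ^ q ^ t * X 1 ^ q ^ i - X 0 ^ q ^ i * X 1 ^ q ^ t)
      = X 0 ^ q ^ t * (∑ i ∈ Finset.Ico (t / 2) k,
          C (if i = t / 2 then 1 else c i) * X 1 ^ q ^ i)
        - X 1 ^ q ^ t * (∑ i ∈ Finset.Ico (t / 2) k,
          C (if i = t / 2 then 1 else c i) * X 0 ^ q ^ i) := by
    rw [Finset.mul_sum, Finset.mul_sum, ← Finset.sum_sub_distrib]
    exact Finset.sum_congr rfl fun i _ => by ring
  have h2 : ∑ i ∈ Finset.Ico (t / 2) k, C (if i = t / 2 then 1 else c i) *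
      (((X 0 : MvPolynomial (Fin 2) Ω) ^ q ^ 0 * X 1 ^ q ^ i - X 0 ^ q ^ i * X 1 ^ q ^ 0)
        + C δ * (X 0 ^ q ^ (2 * t) * X 1 ^ q ^ i - X 0 ^ q ^ i * X 1 ^ q ^ (2 * t)))
      = (X 0 + C δ * X 0 ^ q ^ (2 * t)) * (∑ i ∈ Finset.Ico (t / 2) k,
          C (if i = t / 2 then 1 else c i) * X 1 ^ q ^ i)
        - (X 1 + C δ * X 1 ^ q ^ (2 * t)) * (∑ i ∈ Finset.Ico (t / 2) k,
          C (if i = t / 2 then 1 else c i) * X 0 ^ q ^ i) := by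
    rw [Finset.mul_sum, Finset.mul_sum, ← Finset.sum_sub_distrib]
    exact Finset.sum_congr rfl fun i _ => by rw [pow_zero]; ring
  rw [h1, h2]
  simp only [Matrix.cons_val', Matrix.cons_val_zero, Matrix.cons_val_one, Matrix.of_apply,
    Matrix.cons_val, Matrix.cons_val_fin_one, pow_zero]
  ring

lemma eval_smul_hom {σ : Type*} [Fintype σ] {P : MvPolynomial σ Ω} {D : ℕ}
    (hP : P.IsHomogeneous D) (z : Ω) (v : σ → Ω) :
    eval (fun i => z * v i) P = z ^ D * eval v P := by
  rw [eval_eq', eval_eq', Finset.mul_sum]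
  refine Finset.sum_congr rfl fun d hd => ?_
  have h := hP.degree_eq_sum_deg_support hd
  simp only [mul_pow, Finset.prod_mul_distrib, Finset.prod_pow_eq_pow_sum]
  have h' : ∑ i, d i = D := by
    rw [h]
    refine (Finset.sum_subset (Finset.subset_univ _) fun x _ hx => ?_).symm
    simpa using hx
  rw [h']; ring

lemma dehom_inj [Infinite Ω] {P Q : MvPolynomial (Fin 3) Ω} {D : ℕ}
    (hP : P.IsHomogeneous D) (hQ : Q.IsHomogeneous D)
    (h : aeval ![(X 0 : MvPolynomial (Fin 2) Ω), X 1, 1] P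
      = aeval ![(X 0 : MvPolynomial (Fin 2) Ω), X 1, 1] Q) : P = Q := by
  have hev : ∀ (R : MvPolynomial (Fin 3) Ω) (x y : Ω),
      eval ![x, y] (aeval ![(X 0 : MvPolynomial (Fin 2) Ω), X 1, 1] R) = eval ![x, y, 1] R := by
    intro R x y
    induction R using MvPolynomial.induction_on with
    | C a => simp
    | add p q hp hq => rw [map_add, map_add, map_add, hp, hq]
    | mul_X p i hp => rw [map_mul, map_mul, hp, map_mul]; fin_cases i <;> simp
  have key : X 2 * P = X 2 * Q := by
    refine MvPolynomial.funext fun v => ?_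
    rw [map_mul, map_mul, eval_X]
    by_cases hz : v 2 = 0
    · simp [hz]
    · have hv : v = fun i => v 2 * (![v 0 / v 2, v 1 / v 2, 1] : Fin 3 → Ω) i := by
        funext i
        fin_cases i <;> simp <;> field_simp
      have e1 : eval v P = eval v Q := by
        rw [hv, eval_smul_hom hP, eval_smul_hom hQ, ← hev, ← hev, h]
      rw [e1]
  exact mul_left_cancel₀ (X_ne_zero 2) key

lemma hc_low {d e : ℕ} (h : d < e) (p : MvPolynomial (Fin 2) Ω) :
    homogeneousComponent d (p * X 1 ^ e) = 0 := by
  ext m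
  rw [coeff_homogeneousComponent, coeff_zero]
  split_ifs with hm
  · rw [X_pow_eq_monomial, coeff_mul_monomial', if_neg]
    intro hle
    have := hle 1
    simp [Finsupp.degree_eq_sum] at this hm
    omega
  · rfl

lemma br2_hom (q i j : ℕ) : (br2 Ω q i j).IsHomogeneous (q ^ i + q ^ j) := by
  unfold br2
  refine ((isHomogeneous_X_pow 0 _).mul (isHomogeneous_X_pow 1 _)).sub ?_
  rw [add_comm]
  exact (isHomogeneous_X_pow 0 _).mul (isHomogeneous_X_pow 1 _)

lemma br3_hom (q D i j : ℕ) (h : q ^ i + q ^ j ≤ D) : (br3 Ω q D i j).IsHomogeneous D := by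
  unfold br3
  have h1 : (X 0 ^ q ^ i * X 1 ^ q ^ j - X 0 ^ q ^ j * X 1 ^ q ^ i :
      MvPolynomial (Fin 3) Ω).IsHomogeneous (q ^ i + q ^ j) := by
    refine ((isHomogeneous_X_pow 0 _).mul (isHomogeneous_X_pow 1 _)).sub ?_
    rw [add_comm]
    exact (isHomogeneous_X_pow 0 _).mul (isHomogeneous_X_pow 1 _)
  have h2 := h1.mul (isHomogeneous_X_pow (R := Ω) (2 : Fin 3) (D - (q ^ i + q ^ j)))
  rwa [Nat.add_sub_cancel' h] at h2

lemma two_pow_lt {q i j k t : ℕ} (hq : 2 < q) (h2tk : 2 * t < k) (hi : i ≤ 2 * t) (hj : j < k) :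
    q ^ i + q ^ j < q ^ k := by
  obtain ⟨k, rfl⟩ : ∃ m, k = m + 1 := ⟨k - 1, by omega⟩
  have h1 : q ^ i ≤ q ^ k := Nat.pow_le_pow_right (by omega) (by omega)
  have h2 : q ^ j ≤ q ^ k := Nat.pow_le_pow_right (by omega) (by omega)
  have h3 : 0 < q ^ k := by positivity
  rw [pow_succ]
  nlinarith

lemma mult_eq {f : MvPolynomial (Fin 2) Ω} {m : ℕ} (h0 : ∀ d < m, homogeneousComponent d f = 0)
    (h1 : homogeneousComponent m f ≠ 0) : multAt f = m := by
  unfold multAt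
  refine le_antisymm (Nat.sInf_le h1) (le_csInf ⟨m, h1⟩ fun d hd => ?_)
  by_contra hlt
  exact hd (h0 d (by omega))

lemma hc_XX (m n d : ℕ) : homogeneousComponent d (X 0 ^ m * X 1 ^ n : MvPolynomial (Fin 2) Ω)
    = if m + n = d then X 0 ^ m * X 1 ^ n else 0 := by
  rw [homogeneousComponent_of_mem (m := d) (n := m + n)
    ((isHomogeneous_X_pow 0 _).mul (isHomogeneous_X_pow 1 _))]
  simp only [eq_comm]

lemma hc_loc {q t k i d : ℕ} (hq : 2 < q) (h2tk : 2 * t < k) (hi : i ≤ 2 * t)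
    (hd : d ≤ q ^ (2 * t)) (c : Ω) :
    homogeneousComponent d ((X 0 ^ q ^ k - X 0 ^ q ^ i + C c) *
        X 1 ^ (q ^ k + q ^ (2 * t) - (q ^ i + q ^ k)) : MvPolynomial (Fin 2) Ω)
      = (if d = q ^ (2 * t) then - (X 0 ^ q ^ i * X 1 ^ (q ^ (2 * t) - q ^ i)) else 0)
        + (if d = q ^ (2 * t) - q ^ i then C c * X 1 ^ (q ^ (2 * t) - q ^ i) else 0) := by
  have h1 : q ^ i ≤ q ^ (2 * t) := Nat.pow_le_pow_right (by omega) hi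
  have h2 : q ^ (2 * t) < q ^ k := Nat.pow_lt_pow_right (by omega) h2tk
  have h3 : q ^ k + q ^ (2 * t) - (q ^ i + q ^ k) = q ^ (2 * t) - q ^ i := by omega
  rw [h3]
  generalize q ^ (2 * t) = N at *
  generalize q ^ i = I at *
  generalize q ^ k = K at *
  have e : ((X 0 ^ K - X 0 ^ I + C c) * X 1 ^ (N - I) : MvPolynomial (Fin 2) Ω)
      = X 0 ^ K * X 1 ^ (N - I) - X 0 ^ I * X 1 ^ (N - I)
        + C c * (X 0 ^ 0 * X 1 ^ (N - I)) := by ring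
  rw [e, map_add, map_sub, homogeneousComponent_C_mul, hc_XX, hc_XX, hc_XX,
    if_neg (show ¬ (K + (N - I) = d) by omega), zero_sub, Nat.add_sub_cancel' h1, zero_add]
  congr 1
  · simp only [eq_comm (a := N)]; split_ifs <;> simp
  · simp only [eq_comm (a := N - I)]; split_ifs <;> simp

lemma nonvan {T N m₁ m₂ m₃ : ℕ} (hT : 1 ≠ T) (hN : 1 ≠ N) {a b Cc δ : Ω} (ha : a ≠ 0) (hC : Cc ≠ 0) :
    a • Cc • (-(X 0 ^ 1 * X 1 ^ m₁) + δ • (-(X 0 ^ N * X 1 ^ m₂)))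
      - b • Cc • (-(X 0 ^ T * X 1 ^ m₃)) ≠ (0 : MvPolynomial (Fin 2) Ω) := by
  intro h
  have h2 := congrArg (fun p => (aeval ![(Polynomial.X : Polynomial Ω), 1] p).coeff 1) h
  simp [Polynomial.coeff_X_pow, hT, hN, ha, hC] at h2

lemma fxi_br3 {p m q : ℕ} [Fact p.Prime] [CharP Ω p] (hq : q = p ^ m) (D i j : ℕ) (ξ : Ω) :
    fxi (br3 Ω q D i j) ξ = (X 0 ^ q ^ j - X 0 ^ q ^ i + C (ξ ^ q ^ j - ξ ^ q ^ i)) *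
        X 1 ^ (D - (q ^ i + q ^ j)) := by
  have hadd : ∀ s, ((X 0 : MvPolynomial (Fin 2) Ω) + C ξ) ^ q ^ s = X 0 ^ q ^ s + C ξ ^ q ^ s := by
    intro s
    rw [hq, ← pow_mul]
    exact add_pow_char_pow ..
  unfold fxi br3
  simp only [map_mul, map_sub, map_pow, aeval_X, Matrix.cons_val_zero, Matrix.cons_val_one,
    Matrix.cons_val, one_pow, one_mul, hadd]
  ring

lemma frob_inj {p m q : ℕ} [Fact p.Prime] [CharP Ω p] (hq : q = p ^ m) (s : ℕ) {x y : Ω}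
    (h : x ^ q ^ s = y ^ q ^ s) : x = y := by
  rw [hq, ← pow_mul] at h
  have : (x - y) ^ p ^ (m * s) = 0 := by rw [sub_pow_char_pow, h, sub_self]
  exact sub_eq_zero.mp (pow_eq_zero_iff (pow_ne_zero _ (Fact.out : p.Prime).ne_zero) |>.mp this)

lemma fix_add {q a b : ℕ} {x : Ω} (ha : x ^ q ^ a = x) (hb : x ^ q ^ b = x) :
    x ^ q ^ (a + b) = x := by
  rw [pow_add, pow_mul, ha, hb]

lemma fix_mul {q a : ℕ} {x : Ω} (ha : x ^ q ^ a = x) (b : ℕ) : x ^ q ^ (a * b) = x := by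
  induction b with
  | zero => simp
  | succ b ih => rw [Nat.mul_succ]; exact fix_add ih ha

lemma fix_gcd {q a b : ℕ} {x : Ω} (ha : x ^ q ^ a = x) (hb : x ^ q ^ b = x) :
    x ^ q ^ (Nat.gcd a b) = x := by
  have h : ∀ s, Function.IsPeriodicPt (fun y : Ω => y ^ q) s x ↔ x ^ q ^ s = x := by
    intro s
    rw [Function.IsPeriodicPt, Function.IsFixedPt, pow_iterate]
  rw [← h] at *
  exact ha.gcd hb

end helpers

/-- In the setting (case `mindeg_q G = t/2`, `t` even) with `q > 2`:
(i) the top homogeneous component of `F_C` (of degree `q^k + q^(2t)`) equals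
`λ^(q^t) δ C (X^(q^(2t)) Y^(q^k) − X^(q^k) Y^(q^(2t)))`; consequently the points at
infinity of the projective curve `C` are exactly `(0:1:0)` and `(1:ξ:0)` with
`ξ^(q^(k−2t)) = ξ`. (ii) For each such `ξ`, the multiplicity of `P_ξ` belongs to
`{q^(2t)−q^t, q^(2t)}`, and equals `q^(2t)` iff `ξ^(q^(gcd(k,t))) = ξ`. -/
theorem stmt_4 (q n t k : ℕ) (hq2 : 2 < q)
    (F0 : Type) [Field F0] [Fintype F0] (hF0 : Fintype.card F0 = q)
    (ht : 0 < t) (hteven : t % 2 = 0) (h2tk : 2 * t < k) (hkn : k < n)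
    (δ l Cc : AlgebraicClosure F0) (c : ℕ → AlgebraicClosure F0)
    (hδK : δ ^ q ^ n = δ) (hlK : l ^ q ^ n = l) (hCcK : Cc ^ q ^ n = Cc)
    (hcK : ∀ i, c i ^ q ^ n = c i)
    (hnorm : δ ^ ((q ^ n - 1) / (q - 1)) ≠ 1) (hCc : Cc ≠ 0)
    (hlq : l ^ q ≠ l)
    (hFl : Fval q t δ l ≠ 0) (hGl : Gval2 q t k c Cc l ≠ 0)
    (hLξ : ∀ ξ : AlgebraicClosure F0, ξ ^ q ^ (k - 2 * t) = ξ → ξ ^ q ^ (k - t) ≠ ξ →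
      (ξ - ξ ^ q ^ t) ^ q ^ (k + t) * (ξ ^ q ^ (k - t) - ξ) ^ q ^ t
          * Fval q t δ l ^ (q ^ t + 1)
        + δ * (ξ ^ q ^ k - ξ) ^ (q ^ t * (q ^ t + 1)) * l ^ (q ^ t * (q ^ t + 1)) ≠ 0)
    (FCh : MvPolynomial (Fin 3) (AlgebraicClosure F0))
    (hhom : FCh.IsHomogeneous (q ^ k + q ^ (2 * t)))
    (hdeh : aeval ![X 0, X 1, 1] FCh = FC2 q t k δ c Cc l) :
    homogeneousComponent (q ^ k + q ^ (2 * t)) (FC2 q t k δ c Cc l)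
        = C (l ^ q ^ t * δ * Cc)
            * ((X 0) ^ q ^ (2 * t) * (X 1) ^ q ^ k
                - (X 0) ^ q ^ k * (X 1) ^ q ^ (2 * t)) ∧
    (∀ x y : AlgebraicClosure F0, (x, y) ≠ (0, 0) →
        (x ^ q ^ (2 * t) * y ^ q ^ k - x ^ q ^ k * y ^ q ^ (2 * t) = 0 ↔
          x = 0 ∨ ∃ ξ : AlgebraicClosure F0, ξ ^ q ^ (k - 2 * t) = ξ ∧ y = ξ * x)) ∧
    (∀ ξ : AlgebraicClosure F0, ξ ^ q ^ (k - 2 * t) = ξ →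
        ((multAt (fxi FCh ξ) = q ^ (2 * t) - q ^ t ∨ multAt (fxi FCh ξ) = q ^ (2 * t)) ∧
          (multAt (fxi FCh ξ) = q ^ (2 * t) ↔ ξ ^ q ^ Nat.gcd k t = ξ))) := by
  obtain ⟨p, hpc⟩ := CharP.exists F0
  obtain ⟨m, hp, hqm⟩ := FiniteField.card F0 p
  rw [hF0] at hqm
  have : Fact p.Prime := ⟨hp⟩
  have : CharP (AlgebraicClosure F0) p := charP_of_injective_algebraMap
    (algebraMap F0 (AlgebraicClosure F0)).injective p
  have : Infinite (AlgebraicClosure F0) := IsAlgClosed.instInfinite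
  have hl : l ≠ 0 := by
    rintro rfl
    exact hlq (zero_pow (by omega))
  have ha : l ^ q ^ t ≠ 0 := pow_ne_zero _ hl
  have hT1 : 1 < q ^ t := Nat.one_lt_pow (by omega) (by omega)
  have hTN : q ^ t < q ^ (2 * t) := Nat.pow_lt_pow_right (by omega) (by omega)
  have hNK : q ^ (2 * t) < q ^ k := Nat.pow_lt_pow_right (by omega) h2tk
  have hFC := FC2_eq q t k (by omega) δ c Cc l
  refine ⟨?_, ?_, ?_⟩
  · rw [hFC, Ex_map, Ex_collapse t k h2tk]
    · rw [homogeneousComponent_of_mem (br2_hom q t k), homogeneousComponent_of_mem (br2_hom q 0 k),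
        homogeneousComponent_of_mem (br2_hom q (2 * t) k), if_neg (by rw [pow_zero]; omega),
        if_pos (by omega), if_neg (by omega)]
      simp only [smul_zero, sub_zero, zero_add, MvPolynomial.smul_eq_C_mul, C_mul, br2]
      ring
    · intro i j hi hj
      have := two_pow_lt hq2 h2tk hi hj
      rw [homogeneousComponent_of_mem (br2_hom q i j), if_neg (by omega)]
  · intro x y hxy
    have hqpos : 0 < q := by omega
    by_cases hx : x = 0
    · subst hx
      simp [zero_pow (pow_pos hqpos _).ne']
    · have hsplit : ∀ z : AlgebraicClosure F0,
          z ^ q ^ k = (z ^ q ^ (k - 2 * t)) ^ q ^ (2 * t) := by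
        intro z
        rw [← pow_mul, ← pow_add]
        congr 2
        omega
      constructor
      · intro h
        refine Or.inr ⟨y / x, ?_, by field_simp⟩
        apply frob_inj hqm (2 * t)
        rw [← hsplit, div_pow, div_pow, div_eq_div_iff (pow_ne_zero _ hx) (pow_ne_zero _ hx)]
        linear_combination h
      · rintro (h | ⟨ξ, h1, rfl⟩)
        · exact absurd h hx
        · rw [mul_pow, mul_pow, hsplit ξ, h1]
          ring
  · intro ξ hξ
    have hH : FCh = Ex t k δ (l ^ q ^ t) (Fval q t δ l) (Gval2 q t k c Cc l) Cc
        (fun i => if i = t / 2 then 1 else c i)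
        (br3 (AlgebraicClosure F0) q (q ^ k + q ^ (2 * t))) := by
      refine dehom_inj hhom ?_ ?_
      · rw [← mem_homogeneousSubmodule]
        refine Ex_mem _ t k h2tk _ _ _ _ _ _ _ fun i j hi hj => ?_
        rw [mem_homogeneousSubmodule]
        refine br3_hom _ _ _ _ ?_
        have h1 : q ^ i ≤ q ^ (2 * t) := Nat.pow_le_pow_right (by omega) hi
        have h2 : q ^ j ≤ q ^ k := Nat.pow_le_pow_right (by omega) hj
        omega
      · rw [hdeh, hFC, ← AlgHom.toLinearMap_apply, Ex_map]
        congr 1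
        funext i j
        simp [br2, br3]
    have hcomp : ∀ d ≤ q ^ (2 * t), homogeneousComponent d (fxi FCh ξ)
        = (l ^ q ^ t) • Cc • (((if d = q ^ (2 * t) then
              - (X 0 ^ q ^ 0 * X 1 ^ (q ^ (2 * t) - q ^ 0)) else 0)
            + (if d = q ^ (2 * t) - q ^ 0 then
              C (ξ ^ q ^ k - ξ ^ q ^ 0) * X 1 ^ (q ^ (2 * t) - q ^ 0) else 0))
            + δ • ((if d = q ^ (2 * t) then
              - (X 0 ^ q ^ (2 * t) * X 1 ^ (q ^ (2 * t) - q ^ (2 * t))) else 0)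
            + (if d = q ^ (2 * t) - q ^ (2 * t) then
              C (ξ ^ q ^ k - ξ ^ q ^ (2 * t)) * X 1 ^ (q ^ (2 * t) - q ^ (2 * t)) else 0)))
          - Fval q t δ l • Cc • ((if d = q ^ (2 * t) then
              - (X 0 ^ q ^ t * X 1 ^ (q ^ (2 * t) - q ^ t)) else 0)
            + (if d = q ^ (2 * t) - q ^ t then
              C (ξ ^ q ^ k - ξ ^ q ^ t) * X 1 ^ (q ^ (2 * t) - q ^ t) else 0)) := by
      intro d hd
      have e1 : fxi FCh ξ = Ex t k δ (l ^ q ^ t) (Fval q t δ l) (Gval2 q t k c Cc l) Cc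
          (fun i => if i = t / 2 then 1 else c i)
          (fun i j => fxi (br3 (AlgebraicClosure F0) q (q ^ k + q ^ (2 * t)) i j) ξ) := by
        rw [hH]
        unfold fxi
        rw [← AlgHom.toLinearMap_apply, Ex_map]
        rfl
      rw [e1, Ex_map, Ex_collapse t k h2tk]
      · rw [fxi_br3 hqm, fxi_br3 hqm, fxi_br3 hqm, hc_loc hq2 h2tk (by omega) hd,
          hc_loc hq2 h2tk (by omega) hd, hc_loc hq2 h2tk (by omega) hd]
      · intro i j hi hj
        have := two_pow_lt hq2 h2tk hi hj
        rw [fxi_br3 hqm]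
        exact hc_low (by omega) _
    have h2t : ξ ^ q ^ k = ξ ^ q ^ (2 * t) := by
      have : k = (k - 2 * t) + 2 * t := by omega
      rw [this, pow_add, pow_mul, hξ]
    have hgcd : Nat.gcd k t = Nat.gcd (k - 2 * t) t := by
      have : k = (k - 2 * t) + 2 * t := by omega
      conv_lhs => rw [this]
      simp
    rw [h2t, sub_self] at hcomp
    by_cases hg : ξ ^ q ^ Nat.gcd k t = ξ
    · have hfix : ξ ^ q ^ t = ξ := by
        obtain ⟨r, hr⟩ := Nat.gcd_dvd_right k t
        rw [hr]
        have := fix_mul hg r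
        rwa [← hr] at this ⊢
      have hfix2 : ξ ^ q ^ (2 * t) = ξ := by rw [two_mul]; exact fix_add hfix hfix
      have hm : multAt (fxi FCh ξ) = q ^ (2 * t) := by
        refine mult_eq (fun d hd => ?_) ?_
        · rw [hcomp d hd.le, hfix, hfix2]
          simp [hd.ne]
        · rw [hcomp _ le_rfl, hfix, hfix2]
          simp only [pow_zero, pow_one, sub_self, C_0, zero_mul, ite_self, add_zero, if_true]
          have := nonvan (Ω := AlgebraicClosure F0) (T := q ^ t) (N := q ^ (2 * t))
            (m₁ := q ^ (2 * t) - 1) (m₂ := 0) (m₃ := q ^ (2 * t) - q ^ t)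
            (b := Fval q t δ l) (δ := δ) (by omega) (by omega) ha hCc
          simpa using this
      exact ⟨Or.inr hm, fun _ => hg, fun _ => hm⟩
    · have hne : ξ ^ q ^ (2 * t) - ξ ^ q ^ t ≠ 0 := by
        intro h
        apply hg
        rw [hgcd]
        refine fix_gcd hξ (frob_inj hqm t ?_)
        rw [← pow_mul, ← pow_add, ← two_mul]
        exact sub_eq_zero.mp h
      have hm : multAt (fxi FCh ξ) = q ^ (2 * t) - q ^ t := by
        refine mult_eq (fun d hd => ?_) ?_
        · rw [hcomp d (by omega)]
          have n1 : ¬ d = q ^ (2 * t) := by omega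
          have n2 : ¬ d = q ^ (2 * t) - q ^ 0 := by rw [pow_zero]; omega
          have n3 : ¬ d = q ^ (2 * t) - q ^ t := by omega
          simp only [if_neg n1, if_neg n2, if_neg n3, C_0, zero_mul, ite_self, add_zero,
            smul_zero, sub_zero]
        · rw [hcomp _ (by omega)]
          have n1 : ¬ q ^ (2 * t) - q ^ t = q ^ (2 * t) := by omega
          have n2 : ¬ q ^ (2 * t) - q ^ t = q ^ (2 * t) - q ^ 0 := by rw [pow_zero]; omega
          simp only [if_neg n1, if_neg n2, if_true, C_0, zero_mul, ite_self, add_zero, zero_add,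
            smul_zero, zero_sub]
          exact neg_ne_zero.mpr (smul_ne_zero hFl (smul_ne_zero hCc (mul_ne_zero
            (by rwa [Ne, C_eq_zero]) (pow_ne_zero _ (X_ne_zero 1)))))
      refine ⟨Or.inl hm, fun h => ?_, fun h => absurd h hg⟩
      omega



end
end

section
/- Assume the setting below (case mindeg_q(G)=2t), and let (x̄, ȳ) be a pair in the algebraic closure of F_q with det[[x̄^{q^t}, G(x̄)],[λ^{q^t}, G(λ)]] = det[[ȳ^{q^t}, G(ȳ)],[λ^{q^t}, G(λ)]] = 0. Write F_C(X + x̄, Y + ȳ) = ∑_d H_d(X,Y) with H_d zero or homogeneous of degree d. Then H_d = 0 for all d < q^t, H_{q^t}(X,Y) = det[[F(ȳ), G(ȳ)],[F(λ), G(λ)]]·X^{q^t} − det[[F(x̄), G(x̄)],[F(λ), G(λ)]]·Y^{q^t}, and H_{q^t+1}(X,Y) = G(λ)·(X^{q^t} Y − X Y^{q^t}). -/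
open MvPolynomial

noncomputable section

/-- `G(x) = x^(q^(2t)) + ∑_{i=2t+1}^{k-1} c_i x^(q^i) + C x^(q^k)` (value at `x`). -/
def Gval (q t k : ℕ) {Ω : Type*} [Field Ω] (c : ℕ → Ω) (Cc x : Ω) : Ω :=
  x ^ q ^ (2 * t) + (∑ i ∈ Finset.Ico (2 * t + 1) k, c i * x ^ q ^ i) + Cc * x ^ q ^ k

/-- `G` applied to a bivariate polynomial. -/
def GP (q t k : ℕ) {Ω : Type*} [Field Ω] (c : ℕ → Ω) (Cc : Ω) (u : MvPolynomial (Fin 2) Ω) :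
    MvPolynomial (Fin 2) Ω :=
  u ^ q ^ (2 * t) + (∑ i ∈ Finset.Ico (2 * t + 1) k, C (c i) * u ^ q ^ i) + C Cc * u ^ q ^ k

/-- The affine equation `F_C(X,Y)` of the curve `C`. -/
def FC (q t k : ℕ) {Ω : Type*} [Field Ω] (δ : Ω) (c : ℕ → Ω) (Cc l : Ω) :
    MvPolynomial (Fin 2) Ω :=
  Matrix.det !![(X 0) ^ q ^ t, FP q t δ (X 0), GP q t k c Cc (X 0);
                (X 1) ^ q ^ t, FP q t δ (X 1), GP q t k c Cc (X 1);
                C (l ^ q ^ t), C (Fval q t δ l), C (Gval q t k c Cc l)]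

theorem aux_hc {Ω : Type*} [Field Ω] (i : ℕ) (m d : ℕ) (h : d < m)
    (a : MvPolynomial ℕ Ω) : homogeneousComponent d (X i ^ m * a) = 0 := by
  ext e
  rw [coeff_homogeneousComponent, coeff_zero]
  split_ifs with he
  · rw [X_pow_eq_monomial, coeff_monomial_mul', if_neg]
    intro hle
    have h1 := hle i
    rw [Finsupp.single_eq_same] at h1
    have h2 := Finsupp.le_degree i e
    omega
  · rfl

theorem aux_hc_hom {Ω : Type*} [Field Ω] {m d : ℕ}
    {a : MvPolynomial ℕ Ω} (ha : a.IsHomogeneous m) :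
    homogeneousComponent d a = if d = m then a else 0 :=
  homogeneousComponent_of_mem ha

theorem aux_FP {Ω : Type*} [Field Ω] (q t : ℕ) (δ b : Ω)
    (hadd : ∀ (i : ℕ) (u v : MvPolynomial (Fin 2) Ω), (u + v) ^ q ^ i = u ^ q ^ i + v ^ q ^ i)
    (u : MvPolynomial (Fin 2) Ω) :
    FP q t δ (u + C b) = FP q t δ u + C (Fval q t δ b) := by
  simp only [FP, Fval, hadd, map_add, map_mul, map_pow]
  ring

theorem aux_GP {Ω : Type*} [Field Ω] (q t k : ℕ) (c : ℕ → Ω) (Cc b : Ω)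
    (hadd : ∀ (i : ℕ) (u v : MvPolynomial (Fin 2) Ω), (u + v) ^ q ^ i = u ^ q ^ i + v ^ q ^ i)
    (u : MvPolynomial (Fin 2) Ω) :
    GP q t k c Cc (u + C b) = GP q t k c Cc u + C (Gval q t k c Cc b) := by
  simp only [GP, Gval, hadd, map_add, map_mul, map_pow, map_sum, mul_add,
    Finset.sum_add_distrib]
  ring

theorem aux_pow_le (q t i : ℕ) (hq : 2 ≤ q) (ht : 0 < t) (hi : 2 * t ≤ i) :
    q ^ t + 2 ≤ q ^ i := by
  have h1 : q ^ (2 * t) ≤ q ^ i := Nat.pow_le_pow_right (by omega) hi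
  have h2 : q ^ (2 * t) = q ^ t * q ^ t := by rw [two_mul, pow_add]
  have h3 : q ^ 1 ≤ q ^ t := Nat.pow_le_pow_right (by omega) ht
  nlinarith

theorem aux_GP_dvd {Ω : Type*} [Field Ω] (q t k : ℕ) (hq : 2 ≤ q) (ht : 0 < t)
    (h2tk : 2 * t < k) (c : ℕ → Ω) (Cc : Ω)
    (u : MvPolynomial (Fin 2) Ω) : u ^ (q ^ t + 2) ∣ GP q t k c Cc u := by
  unfold GP
  refine dvd_add (dvd_add ?_ (Finset.dvd_sum fun i hi => ?_)) ?_
  · exact pow_dvd_pow _ (aux_pow_le q t _ hq ht le_rfl)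
  · rw [Finset.mem_Ico] at hi
    exact (pow_dvd_pow _ (aux_pow_le q t _ hq ht (by omega))).mul_left _
  · exact (pow_dvd_pow _ (aux_pow_le q t _ hq ht (by omega))).mul_left _

theorem aux_FP_eq {Ω : Type*} [Field Ω] (q t : ℕ) (hq : 2 ≤ q) (ht : 0 < t) (δ : Ω)
    (u : MvPolynomial (Fin 2) Ω) : ∃ f, FP q t δ u = u + u ^ (q ^ t + 2) * f := by
  obtain ⟨f, hf⟩ : u ^ (q ^ t + 2) ∣ C δ * u ^ q ^ (2 * t) :=
    (pow_dvd_pow _ (aux_pow_le q t _ hq ht le_rfl)).mul_left _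
  exact ⟨f, by rw [FP, hf]⟩

theorem aux_aeval {Ω : Type*} [Field Ω] (q t k : ℕ) (δ : Ω) (c : ℕ → Ω) (Cc l : Ω)
    (v : Fin 2 → MvPolynomial (Fin 2) Ω) :
    aeval v (FC q t k δ c Cc l) =
      v 0 ^ q ^ t * (FP q t δ (v 1) * C (Gval q t k c Cc l)
          - GP q t k c Cc (v 1) * C (Fval q t δ l))
      - FP q t δ (v 0) * (v 1 ^ q ^ t * C (Gval q t k c Cc l)
          - GP q t k c Cc (v 1) * C (l ^ q ^ t))
      + GP q t k c Cc (v 0) * (v 1 ^ q ^ t * C (Fval q t δ l)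
          - FP q t δ (v 1) * C (l ^ q ^ t)) := by
  have hC : ∀ a : Ω, aeval v (C a : MvPolynomial (Fin 2) Ω) = C a := fun a => by
    rw [aeval_C]; rfl
  have hF : ∀ i, aeval v (FP q t δ (X i)) = FP q t δ (v i) := fun i => by
    simp only [FP, map_add, map_mul, map_pow, aeval_X, hC]
  have hG : ∀ i, aeval v (GP q t k c Cc (X i)) = GP q t k c Cc (v i) := fun i => by
    simp only [GP, map_add, map_mul, map_pow, map_sum, aeval_X, hC]
  rw [FC, Matrix.det_fin_three]
  simp only [Matrix.of_apply, Matrix.cons_val', Matrix.cons_val_zero, Matrix.cons_val_one,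
    Matrix.cons_val]
  generalize Gval q t k c Cc l = A
  generalize Fval q t δ l = B
  generalize l ^ q ^ t = D
  simp only [map_add, map_sub, map_mul, hF, hG, hC, map_pow, aeval_X]
  ring

theorem aux_main {Ω : Type*} [Field Ω] (q t k : ℕ) (hq : 2 ≤ q) (ht : 0 < t)
    (h2tk : 2 * t < k)
    (hadd : ∀ (i : ℕ) (u v : MvPolynomial (Fin 2) Ω), (u + v) ^ q ^ i = u ^ q ^ i + v ^ q ^ i)
    (δ l Cc : Ω) (c : ℕ → Ω) (hGl : Gval q t k c Cc l ≠ 0) (xb yb : Ω)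
    (hxb : xb ^ q ^ t * Gval q t k c Cc l - Gval q t k c Cc xb * l ^ q ^ t = 0)
    (hyb : yb ^ q ^ t * Gval q t k c Cc l - Gval q t k c Cc yb * l ^ q ^ t = 0) :
    ∃ a b : MvPolynomial (Fin 2) Ω,
      aeval ![X 0 + C xb, X 1 + C yb] (FC q t k δ c Cc l) =
      (C (Fval q t δ yb * Gval q t k c Cc l - Gval q t k c Cc yb * Fval q t δ l)
            * (X 0) ^ q ^ t
        - C (Fval q t δ xb * Gval q t k c Cc l - Gval q t k c Cc xb * Fval q t δ l)
            * (X 1) ^ q ^ t)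
      + C (Gval q t k c Cc l) * ((X 0) ^ q ^ t * X 1 - X 0 * (X 1) ^ q ^ t)
      + (X 0 ^ (q ^ t + 2) * a + X 1 ^ (q ^ t + 2) * b) := by
  obtain ⟨f0, hf0⟩ := aux_FP_eq q t hq ht δ (X 0 : MvPolynomial (Fin 2) Ω)
  obtain ⟨f1, hf1⟩ := aux_FP_eq q t hq ht δ (X 1 : MvPolynomial (Fin 2) Ω)
  obtain ⟨g0, hg0⟩ := aux_GP_dvd q t k hq ht h2tk c Cc (X 0 : MvPolynomial (Fin 2) Ω)
  obtain ⟨g1, hg1⟩ := aux_GP_dvd q t k hq ht h2tk c Cc (X 1 : MvPolynomial (Fin 2) Ω)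
  rw [aux_aeval]
  simp only [Matrix.cons_val_zero, Matrix.cons_val_one, aux_FP q t δ _ hadd,
    aux_GP q t k c Cc _ hadd, hadd, hf0, hf1, hg0, hg1, ← C_pow]
  generalize Gval q t k c Cc l = l3 at *
  generalize Fval q t δ l = l2 at *
  generalize l ^ q ^ t = l1 at *
  generalize Gval q t k c Cc xb = x3 at *
  generalize Fval q t δ xb = x2 at *
  generalize xb ^ q ^ t = x1 at *
  generalize Gval q t k c Cc yb = y3 at *
  generalize Fval q t δ yb = y2 at *
  generalize yb ^ q ^ t = y1 at *
  have hD : x1 * (y2 * l3 - y3 * l2) - x2 * (y1 * l3 - y3 * l1) + x3 * (y1 * l2 - y2 * l1) = 0 := by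
    apply (mul_right_inj' hGl).1
    linear_combination (y2 * l3 - l2 * y3) * hxb + (l2 * x3 - x2 * l3) * hyb
  have hD' := congrArg (C (σ := Fin 2)) hD
  have hx' := congrArg (C (σ := Fin 2)) hxb
  have hy' := congrArg (C (σ := Fin 2)) hyb
  simp only [map_add, map_sub, map_mul, map_zero] at hD' hx' hy' ⊢
  generalize (X 0 : MvPolynomial (Fin 2) Ω) ^ (q ^ t + 2) = m0
  generalize (X 1 : MvPolynomial (Fin 2) Ω) ^ (q ^ t + 2) = m1
  generalize (X 0 : MvPolynomial (Fin 2) Ω) ^ (q ^ t) = u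
  generalize (X 1 : MvPolynomial (Fin 2) Ω) ^ (q ^ t) = w
  refine ⟨-f0 * w * C l3 + g0 * (w * C l2 - (X 1 + m1 * f1) * C l1)
      + g0 * (C y1 * C l2 - C y2 * C l1),
    u * (f1 * C l3 - g1 * C l2) + (X 0 + m0 * f0) * g1 * C l1
      - g1 * (C x1 * C l2 - C x2 * C l1), ?_⟩
  linear_combination hD' + (X 1 + m1 * f1) * hx' - (X 0 + m0 * f0) * hy'

theorem aux_final {Ω : Type*} [Field Ω] (q t k : ℕ) (hq : 2 ≤ q) (ht : 0 < t)
    (h2tk : 2 * t < k)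
    (hadd : ∀ (i : ℕ) (u v : MvPolynomial (Fin 2) Ω), (u + v) ^ q ^ i = u ^ q ^ i + v ^ q ^ i)
    (δ l Cc : Ω) (c : ℕ → Ω) (hGl : Gval q t k c Cc l ≠ 0) (xb yb : Ω)
    (hxb : xb ^ q ^ t * Gval q t k c Cc l - Gval q t k c Cc xb * l ^ q ^ t = 0)
    (hyb : yb ^ q ^ t * Gval q t k c Cc l - Gval q t k c Cc yb * l ^ q ^ t = 0) :
    (∀ d : ℕ, d < q ^ t →
        homogeneousComponent d
          (aeval ![X 0 + C xb, X 1 + C yb] (FC q t k δ c Cc l)) = 0) ∧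
    homogeneousComponent (q ^ t)
        (aeval ![X 0 + C xb, X 1 + C yb] (FC q t k δ c Cc l))
      = C (Fval q t δ yb * Gval q t k c Cc l - Gval q t k c Cc yb * Fval q t δ l)
            * (X 0) ^ q ^ t
        - C (Fval q t δ xb * Gval q t k c Cc l - Gval q t k c Cc xb * Fval q t δ l)
            * (X 1) ^ q ^ t ∧
    homogeneousComponent (q ^ t + 1)
        (aeval ![X 0 + C xb, X 1 + C yb] (FC q t k δ c Cc l))
      = C (Gval q t k c Cc l) * ((X 0) ^ q ^ t * X 1 - X 0 * (X 1) ^ q ^ t) := by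
  obtain ⟨a, b, hab⟩ := aux_main q t k hq ht h2tk hadd δ l Cc c hGl xb yb hxb hyb
  have hab2 := congrArg (rename (fun i : Fin 2 => (i : ℕ))) hab
  have hcomp : rename (fun i : Fin 2 => (i : ℕ))
      (aeval ![X 0 + C xb, X 1 + C yb] (FC q t k δ c Cc l)) =
      aeval ![(X 0 + C xb : MvPolynomial ℕ Ω), X 1 + C yb] (FC q t k δ c Cc l) := by
    rw [← AlgHom.comp_apply, comp_aeval]
    congr 2
    funext i
    fin_cases i <;> simp [rename_X, rename_C]
  rw [hcomp] at hab2
  simp only [map_add, map_sub, map_mul, map_pow, rename_X, rename_C, Fin.val_zero,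
    Fin.val_one] at hab2
  simp only [← map_mul, ← map_sub] at hab2
  have hX : ∀ i : ℕ, (X i ^ q ^ t : MvPolynomial ℕ Ω).IsHomogeneous
      (q ^ t) := fun i => isHomogeneous_X_pow i _
  have hA := ((hX 0).C_mul (Fval q t δ yb * Gval q t k c Cc l
      - Gval q t k c Cc yb * Fval q t δ l)).sub
    ((hX 1).C_mul (Fval q t δ xb * Gval q t k c Cc l - Gval q t k c Cc xb * Fval q t δ l))
  have hB := (((hX 0).mul (isHomogeneous_X _ 1)).sub
    (by simpa only [add_comm] using (isHomogeneous_X _ 0).mul (hX 1))).C_mul (Gval q t k c Cc l)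
  rw [hab2]
  refine ⟨fun d hd => ?_, ?_, ?_⟩
  · rw [map_add, map_add, map_add, aux_hc _ _ _ (by omega), aux_hc _ _ _ (by omega),
      aux_hc_hom hA, aux_hc_hom hB, if_neg (by omega), if_neg (by omega)]
    simp
  · rw [map_add, map_add, map_add, aux_hc _ _ _ (by omega), aux_hc _ _ _ (by omega),
      aux_hc_hom hA, aux_hc_hom hB, if_pos rfl, if_neg (by omega)]
    simp
  · rw [map_add, map_add, map_add, aux_hc _ _ _ (by omega), aux_hc _ _ _ (by omega),
      aux_hc_hom hA, aux_hc_hom hB, if_neg (by omega), if_pos rfl]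
    simp

/-- In the setting (case `mindeg_q G = 2t`), for an affine singular point
`(x̄, ȳ)` of `C`, writing `F_C(X+x̄, Y+ȳ) = ∑_d H_d(X,Y)` with `H_d` homogeneous of degree
`d`, one has `H_d = 0` for `d < q^t`,
`H_(q^t) = det[[F(ȳ),G(ȳ)],[F(λ),G(λ)]]·X^(q^t) − det[[F(x̄),G(x̄)],[F(λ),G(λ)]]·Y^(q^t)`
and `H_(q^t+1) = G(λ)(X^(q^t) Y − X Y^(q^t))`. -/
theorem stmt_8 (q n t k : ℕ)
    (F0 : Type) [Field F0] [Fintype F0] (hF0 : Fintype.card F0 = q)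
    (ht : 0 < t) (h2tk : 2 * t < k) (hkn : k < n)
    (δ l Cc : AlgebraicClosure F0) (c : ℕ → AlgebraicClosure F0)
    (hδK : δ ^ q ^ n = δ) (hlK : l ^ q ^ n = l) (hCcK : Cc ^ q ^ n = Cc)
    (hcK : ∀ i, c i ^ q ^ n = c i)
    (hnorm : δ ^ ((q ^ n - 1) / (q - 1)) ≠ 1) (hCc : Cc ≠ 0)
    (hlq : l ^ q ≠ l)
    (hFl : Fval q t δ l ≠ 0) (hGl : Gval q t k c Cc l ≠ 0)
    (xb yb : AlgebraicClosure F0)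
    (hxb : xb ^ q ^ t * Gval q t k c Cc l - Gval q t k c Cc xb * l ^ q ^ t = 0)
    (hyb : yb ^ q ^ t * Gval q t k c Cc l - Gval q t k c Cc yb * l ^ q ^ t = 0) :
    (∀ d : ℕ, d < q ^ t →
        homogeneousComponent d
          (aeval ![X 0 + C xb, X 1 + C yb] (FC q t k δ c Cc l)) = 0) ∧
    homogeneousComponent (q ^ t)
        (aeval ![X 0 + C xb, X 1 + C yb] (FC q t k δ c Cc l))
      = C (Fval q t δ yb * Gval q t k c Cc l - Gval q t k c Cc yb * Fval q t δ l)
            * (X 0) ^ q ^ t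
        - C (Fval q t δ xb * Gval q t k c Cc l - Gval q t k c Cc xb * Fval q t δ l)
            * (X 1) ^ q ^ t ∧
    homogeneousComponent (q ^ t + 1)
        (aeval ![X 0 + C xb, X 1 + C yb] (FC q t k δ c Cc l))
      = C (Gval q t k c Cc l) * ((X 0) ^ q ^ t * X 1 - X 0 * (X 1) ^ q ^ t) := by
  classical
  obtain ⟨p, hp⟩ := CharP.exists F0
  obtain ⟨r, hpp, hr⟩ := FiniteField.card F0 p
  have : Fact p.Prime := ⟨hpp⟩
  have : CharP (AlgebraicClosure F0) p := charP_of_injective_algebraMap' F0 p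
  have hq : q = p ^ (r : ℕ) := hF0 ▸ hr
  have hq2 : 2 ≤ q := hF0 ▸ Fintype.one_lt_card
  have hadd : ∀ (i : ℕ) (u v : MvPolynomial (Fin 2) (AlgebraicClosure F0)),
      (u + v) ^ q ^ i = u ^ q ^ i + v ^ q ^ i := by
    intro i u v
    rw [hq, ← pow_mul, add_pow_char_pow]
  exact aux_final q t k hq2 ht h2tk hadd δ l Cc c hGl xb yb hxb hyb

end
end
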